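/- Expansion of iterated Laplacians of the Japanese bracket: Let n ≥ 1, let m ≥ 1 be an integer, and let r > 0 be a real number. Then there exist real numbers a₀, a₁, …, a_m (depending only on n, r, m) such that for all x ∈ ℝⁿ: (−Δ)^m(⟨x⟩^{−r}) = Σ_{k=0}^{m} a_k·⟨x⟩^{−r−2m−2k}, where the extreme coefficients are given explicitly by a₀ = (∏_{j=0}^{m−1}(r+2j))·(∏_{j=1}^{m}(n−r−2j)) and a_m = (∏_{j=0}^{m−1}(r+2j))·(∏_{j=0}^{m−1}(r+2m+2j)). -/

import Mathlib

open MeasureTheory Real Set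
noncomputable section

abbrev Ω (n : ℕ) := EuclideanSpace ℝ (Fin n)

/-- The Japanese bracket `⟨x⟩ = (1 + |x|²)^{1/2}`. -/
def jb {n : ℕ} (x : Ω n) : ℝ := Real.sqrt (1 + ‖x‖ ^ 2)

/-- The (negative of the) classical Laplacian: `(-Δ)f = -∑ᵢ ∂²f/∂xᵢ²`. -/
def negLap {n : ℕ} (f : Ω n → ℝ) : Ω n → ℝ := fun x =>
  -∑ i : Fin n, fderiv ℝ (fun y => fderiv ℝ f y (EuclideanSpace.single i 1)) x
    (EuclideanSpace.single i 1)

/-- The `m`-fold iterate `(-Δ)^m`. -/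
def negLapIter {n : ℕ} (m : ℕ) (f : Ω n → ℝ) : Ω n → ℝ := negLap^[m] f

/-- The normalizing constant `C(n,s) = 4^s Γ(n/2+s) / (π^{n/2} |Γ(-s)|)` of the
fractional Laplacian. -/
def fracC (n : ℕ) (s : ℝ) : ℝ :=
  4 ^ s * Real.Gamma ((n : ℝ) / 2 + s) / (Real.pi ^ ((n : ℝ) / 2) * |Real.Gamma (-s)|)

/-- The singular integrand defining `(-Δ)^s f (x)`. -/
def fracIntegrand {n : ℕ} (s : ℝ) (f : Ω n → ℝ) (x y : Ω n) : ℝ :=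
  (2 * f x - f (x + y) - f (x - y)) / ‖y‖ ^ ((n : ℝ) + 2 * s)

/-- The fractional Laplacian `(-Δ)^s`, `s ∈ (0,1)`, via the singular integral. -/
def fracLapS {n : ℕ} (s : ℝ) (f : Ω n → ℝ) (x : Ω n) : ℝ :=
  (fracC n s / 2) * ∫ y : Ω n, fracIntegrand s f x y

/-- The fractional Laplacian `(-Δ)^γ := (-Δ)^{γ - [γ]} ∘ (-Δ)^{[γ]}` for non-integer `γ > 1`. -/
def fracLap {n : ℕ} (γ : ℝ) (f : Ω n → ℝ) : Ω n → ℝ :=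
  fracLapS (γ - ⌊γ⌋₊) (negLapIter ⌊γ⌋₊ f)

end

section NegLap

variable {n : ℕ}

theorem jb_pos (x : Ω n) : 0 < jb x :=
  Real.sqrt_pos.mpr (by positivity)

theorem jb_sq (x : Ω n) : jb x ^ 2 = 1 + ‖x‖ ^ 2 :=
  Real.sq_sqrt (by positivity)

theorem contDiff_jb_rpow (p : ℝ) {k : WithTop ℕ∞} : ContDiff ℝ k (fun z : Ω n => jb z ^ p) := by
  have hjb : ContDiff ℝ k (fun z : Ω n => jb z) :=
    (contDiff_const.add (contDiff_norm_sq ℝ)).sqrt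
      fun x => (by positivity : (0 : ℝ) < 1 + ‖x‖ ^ 2).ne'
  exact hjb.rpow_const_of_ne fun x => (jb_pos x).ne'

theorem hasFDerivAt_jb_rpow (p : ℝ) (x : Ω n) :
    HasFDerivAt (fun z : Ω n => jb z ^ p) ((p * jb x ^ (p - 2)) • innerSL ℝ x) x := by
  have hsq : HasFDerivAt (fun z : Ω n => 1 + ‖z‖ ^ 2) ((2 : ℕ) • innerSL ℝ x) x :=
    (hasStrictFDerivAt_norm_sq x).hasFDerivAt.const_add 1
  have hjb : HasFDerivAt (fun z : Ω n => jb z) _ x :=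
    hsq.sqrt (by positivity : (0 : ℝ) < 1 + ‖x‖ ^ 2).ne'
  have hpow : jb x ^ (p - 1) = jb x ^ (p - 2) * jb x := by
    rw [← Real.rpow_add_one (jb_pos x).ne']
    ring_nf
  refine (hjb.rpow_const (p := p) (Or.inl (jb_pos x).ne')).congr_fderiv ?_
  ext v
  have hne := (jb_pos x).ne'
  change p * jb x ^ (p - 1) * (1 / (2 * jb x) * ((2 : ℕ) • inner ℝ x v)) =
    p * jb x ^ (p - 2) * inner ℝ x v
  rw [hpow, nsmul_eq_mul]
  push_cast
  field_simp

theorem fderiv_jb_rpow_single (p : ℝ) (x : Ω n) (i : Fin n) :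
    fderiv ℝ (fun z : Ω n => jb z ^ p) x (EuclideanSpace.single i 1) =
      p * (x i * jb x ^ (p - 2)) := by
  rw [(hasFDerivAt_jb_rpow p x).fderiv]
  simp [EuclideanSpace.inner_single_right]
  ring

theorem fderiv_fderiv_jb_rpow_single (p : ℝ) (x : Ω n) (i : Fin n) :
    fderiv ℝ (fun y => fderiv ℝ (fun z : Ω n => jb z ^ p) y (EuclideanSpace.single i 1)) x
        (EuclideanSpace.single i 1) =
      p * jb x ^ (p - 2) + p * (p - 2) * x i ^ 2 * jb x ^ (p - 4) := by
  simp_rw [fderiv_jb_rpow_single]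
  have hcoord : HasFDerivAt (fun y : Ω n => y i) (EuclideanSpace.proj (𝕜 := ℝ) i) x :=
    ContinuousLinearMap.hasFDerivAt (EuclideanSpace.proj (𝕜 := ℝ) i)
  rw [((hcoord.fun_mul (hasFDerivAt_jb_rpow (p - 2) x)).const_mul p).fderiv]
  simp [EuclideanSpace.inner_single_right]
  ring_nf

theorem negLap_jb_rpow (p : ℝ) (x : Ω n) :
    negLap (fun z : Ω n => jb z ^ p) x =
      -p * (n + p - 2) * jb x ^ (p - 2) + p * (p - 2) * jb x ^ (p - 4) := by
  have hpow : jb x ^ (p - 2) = jb x ^ (p - 4) * jb x ^ 2 := by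
    rw [← Real.rpow_add_natCast (jb_pos x).ne']
    push_cast
    ring_nf
  have hnorm : ∑ i, x i ^ 2 = jb x ^ 2 - 1 := by
    rw [jb_sq, EuclideanSpace.real_norm_sq_eq]
    ring
  simp_rw [negLap, fderiv_fderiv_jb_rpow_single]
  rw [Finset.sum_add_distrib, Finset.sum_const, ← Finset.sum_mul, ← Finset.mul_sum, hnorm, hpow]
  simp
  ring

theorem negLap_sum_const_mul {ι : Type*} (s : Finset ι) (c : ι → ℝ) (f : ι → Ω n → ℝ)
    (hf : ∀ k, ContDiff ℝ 2 (f k)) (x : Ω n) :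
    negLap (fun z => ∑ k ∈ s, c k * f k z) x = ∑ k ∈ s, c k * negLap (f k) x := by
  have hd (k : ι) (y : Ω n) : DifferentiableAt ℝ (f k) y := (hf k).differentiable (by simp) y
  have hd' (k : ι) (v y : Ω n) : DifferentiableAt ℝ (fun z => fderiv ℝ (f k) z v) y :=
    (((hf k).fderiv_right (m := 1) (by norm_num)).clm_apply contDiff_const).differentiable
      (by simp) y
  have hfirst (v y : Ω n) : fderiv ℝ (fun z => ∑ k ∈ s, c k * f k z) y v =
      ∑ k ∈ s, c k * fderiv ℝ (f k) y v := by
    rw [(HasFDerivAt.fun_sum fun k _ => (hd k y).hasFDerivAt.const_mul (c k)).fderiv]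
    simp
  have hsecond (v y : Ω n) : fderiv ℝ (fun z => ∑ k ∈ s, c k * fderiv ℝ (f k) z v) y v =
      ∑ k ∈ s, c k * fderiv ℝ (fun z => fderiv ℝ (f k) z v) y v := by
    rw [(HasFDerivAt.fun_sum fun k _ => (hd' k v y).hasFDerivAt.const_mul (c k)).fderiv]
    simp
  simp_rw [negLap, hfirst, hsecond, mul_neg, Finset.mul_sum, Finset.sum_neg_distrib]
  rw [Finset.sum_comm]

end NegLap

/-- The coefficient of `⟨x⟩^{-r-2m-2k}` in `(-Δ)^m ⟨x⟩^{-r}` on `ℝᵈ`, with `d` real. -/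
def negLapCoeff (d r : ℝ) : ℕ → ℕ → ℝ
  | 0, 0 => 1
  | 0, _ + 1 => 0
  | m + 1, 0 => negLapCoeff d r m 0 * ((r + 2 * m) * (d - r - 2 * (m + 1)))
  | m + 1, k + 1 =>
    negLapCoeff d r m (k + 1) *
        ((r + 2 * m + 2 * (k + 1)) * (d - r - 2 * (m + 1) - 2 * (k + 1))) +
      negLapCoeff d r m k * ((r + 2 * m + 2 * k) * (r + 2 * m + 2 * k + 2))

theorem negLapCoeff_eq_zero_of_lt (d r : ℝ) {m k : ℕ} (h : m < k) :
    negLapCoeff d r m k = 0 := by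
  induction m generalizing k with
  | zero =>
    obtain ⟨k, rfl⟩ := Nat.exists_eq_add_one_of_ne_zero h.ne'
    rw [negLapCoeff]
  | succ m ih =>
    obtain ⟨k, rfl⟩ := Nat.exists_eq_add_one_of_ne_zero (Nat.ne_zero_of_lt h)
    rw [negLapCoeff, ih (by omega), ih (by omega)]
    ring

theorem negLapCoeff_zero_right (d r : ℝ) (m : ℕ) :
    negLapCoeff d r m 0 = (∏ j ∈ Finset.range m, (r + 2 * j)) *
      ∏ j ∈ Finset.range m, (d - r - 2 * (j + 1)) := by
  induction m with
  | zero => simp [negLapCoeff]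
  | succ m ih =>
    rw [negLapCoeff, ih, Finset.prod_range_succ, Finset.prod_range_succ]
    ring

theorem negLapCoeff_self (d r : ℝ) (m : ℕ) :
    negLapCoeff d r m m = (∏ j ∈ Finset.range m, (r + 2 * j)) *
      ∏ j ∈ Finset.range m, (r + 2 * m + 2 * j) := by
  induction m with
  | zero => simp [negLapCoeff]
  | succ m ih =>
    have hshift : (∏ j ∈ Finset.range (m + 1), (r + 2 * (m + 1 : ℕ) + 2 * j)) * (r + 2 * m) =
        (∏ j ∈ Finset.range m, (r + 2 * m + 2 * j)) *
          ((r + 2 * m + 2 * m) * (r + 2 * m + 2 * m + 2)) := by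
      have h := Finset.prod_range_succ' (fun j : ℕ => r + 2 * (m : ℝ) + 2 * j) (m + 1)
      rw [Finset.prod_range_succ, Finset.prod_range_succ] at h
      have hcongr : ∏ j ∈ Finset.range (m + 1), (r + 2 * ((m + 1 : ℕ) : ℝ) + 2 * j) =
          ∏ j ∈ Finset.range (m + 1), (r + 2 * (m : ℝ) + 2 * ((j + 1 : ℕ) : ℝ)) :=
        Finset.prod_congr rfl fun j _ => by push_cast; ring
      rw [hcongr]
      push_cast at h ⊢
      linear_combination -h
    rw [negLapCoeff, ih, negLapCoeff_eq_zero_of_lt d r m.lt_succ_self,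
      Finset.prod_range_succ (fun j : ℕ => r + 2 * (j : ℝ))]
    linear_combination -(∏ j ∈ Finset.range m, (r + 2 * (j : ℝ))) * hshift

theorem negLapIter_jb_rpow {n : ℕ} (r : ℝ) (m : ℕ) (x : Ω n) :
    negLapIter m (fun z : Ω n => jb z ^ (-r)) x =
      ∑ k ∈ Finset.range (m + 1), negLapCoeff n r m k * jb x ^ (-r - 2 * m - 2 * k) := by
  induction m generalizing x with
  | zero => simp [negLapIter, negLapCoeff]
  | succ m ih =>
    rw [negLapIter, Function.iterate_succ_apply', ← negLapIter, funext ih,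
      negLap_sum_const_mul _ _ _ fun k => contDiff_jb_rpow _]
    set e : ℕ → ℝ := fun k => jb x ^ (-r - 2 * (m + 1 : ℕ) - 2 * k)
    set A : ℕ → ℝ := fun k => negLapCoeff n r m k *
      ((r + 2 * m + 2 * k) * (n - r - 2 * (m + 1) - 2 * k)) with hA
    set B : ℕ → ℝ := fun k => negLapCoeff n r m k *
      ((r + 2 * m + 2 * k) * (r + 2 * m + 2 * k + 2)) with hB
    have hterm (k : ℕ) : negLapCoeff n r m k *
        negLap (fun z : Ω n => jb z ^ (-r - 2 * (m : ℝ) - 2 * (k : ℝ))) x =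
        A k * e k + B k * e (k + 1) := by
      have h₁ : -r - 2 * (m : ℝ) - 2 * k - 2 = -r - 2 * (m + 1 : ℕ) - 2 * k := by
        push_cast; ring
      have h₂ : -r - 2 * (m : ℝ) - 2 * k - 4 = -r - 2 * (m + 1 : ℕ) - 2 * (k + 1 : ℕ) := by
        push_cast; ring
      rw [negLap_jb_rpow, h₂, h₁]
      simp only [A, B, e]
      push_cast
      ring
    have hlast : A (m + 1) = 0 := by
      simp [hA, negLapCoeff_eq_zero_of_lt]
    have hzero : negLapCoeff n r (m + 1) 0 = A 0 := by
      simp [hA, negLapCoeff]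
    have hsucc (k : ℕ) : negLapCoeff n r (m + 1) (k + 1) = A (k + 1) + B k := by
      simp [hA, hB, negLapCoeff]
    simp_rw [hterm]
    change _ = ∑ k ∈ Finset.range (m + 1 + 1), negLapCoeff n r (m + 1) k * e k
    rw [Finset.sum_range_succ' (fun k => negLapCoeff n r (m + 1) k * e k), hzero]
    simp_rw [hsucc, add_mul, Finset.sum_add_distrib]
    have hA' := Finset.sum_range_succ' (fun k => A k * e k) (m + 1)
    rw [Finset.sum_range_succ, hlast] at hA'
    linear_combination hA'

open Finset in
/-- **Expansion of iterated Laplacians of the Japanese bracket**: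
`(−Δ)^m ⟨x⟩^{−r} = Σ_{k=0}^{m} a_k ⟨x⟩^{−r−2m−2k}` with explicit extreme coefficients. -/
theorem negLapIter_jb_rpow_expansion (n : ℕ) (hn : 1 ≤ n) (m : ℕ) (hm : 1 ≤ m)
    (r : ℝ) (hr : 0 < r) :
    ∃ a : ℕ → ℝ,
      (∀ x : Ω n, negLapIter m (fun z : Ω n => jb z ^ (-r)) x =
        ∑ k ∈ Finset.range (m + 1), a k * jb x ^ (-r - 2 * m - 2 * k)) ∧
      a 0 = (∏ j ∈ Finset.range m, (r + 2 * j)) *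
        (∏ j ∈ Finset.range m, ((n : ℝ) - r - 2 * (j + 1))) ∧
      a m = (∏ j ∈ Finset.range m, (r + 2 * j)) *
        (∏ j ∈ Finset.range m, (r + 2 * m + 2 * j)) := by
  exact ⟨negLapCoeff n r m, negLapIter_jb_rpow r m, negLapCoeff_zero_right n r m,
    negLapCoeff_self n r m⟩
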